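/- Let α ∈ (0,1) and let g : (0,∞) → ℝ be such that g and y ↦ y·g(y) belong to L¹(0,∞) and g has compact support. Then for all t > 1 and all x > 0, |v^−(x,t) − m·𝔈_t(x)| ≤ (C_2(α)/t^{1/(1+α)})·‖y g(y)‖_{L¹(0,∞)} · ( t^{−1/(1+α)} if x ≤ t^{1/(1+α)}, and 1/x if x > t^{1/(1+α)} ), where C_2(α) = 2 a_0 C_1(α). -/

import Mathlib

open Real MeasureTheory Set Filter Topology

noncomputable def bCoef (α : ℝ) (n : ℕ) : ℝ :=
  ∏ i ∈ Finset.range n, Real.Gamma (α * i + i + 2) / Real.Gamma (α * (i + 1) + i + 2)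

/-- The profile function `Φ(x) = ∑ bₙ (−x^{1+α}/(1+α))ⁿ`. -/
noncomputable def Phi (α : ℝ) (x : ℝ) : ℝ :=
  ∑' n : ℕ, bCoef α n * (-(x ^ (1 + α)) / (1 + α)) ^ n

/-- The Caputo fractional derivative of order `α`. -/
noncomputable def caputo (α : ℝ) (f : ℝ → ℝ) (x : ℝ) : ℝ :=
  (1 / Real.Gamma (1 - α)) * ∫ τ in (0:ℝ)..x, deriv f τ * (x - τ) ^ (-α)

/-- The normalizing constant `a₀` with `1/a₀ = 2∫₀^∞ Φ`. -/
noncomputable def a0 (α : ℝ) : ℝ := (2 * ∫ x in Set.Ioi (0:ℝ), Phi α x)⁻¹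

/-- The fundamental solution `𝔈_t(x) = a₀ t^{−1/(1+α)} Φ(|x| t^{−1/(1+α)})`. -/
noncomputable def fundSol (α t x : ℝ) : ℝ :=
  a0 α * t ^ (-1/(1+α)) * Phi α (|x| * t ^ (-1/(1+α)))

noncomputable def C1 (α : ℝ) : ℝ :=
  α * (2:ℝ) ^ (1+α) * max (∫ u in (1/2:ℝ)..1, u ^ (-(1+α)) * (1-u) ^ (α-1)) 2

noncomputable def C2 (α : ℝ) : ℝ := 2 * a0 α * C1 α


def Ent (a : ℕ → ℝ) : Prop := ∀ R : ℝ, 0 ≤ R → Summable fun n => |a n| * R ^ n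

noncomputable def serS (a : ℕ → ℝ) (z : ℝ) : ℝ := ∑' n, a n * z ^ n

def dS (a : ℕ → ℝ) (n : ℕ) : ℝ := (n + 1) * a (n + 1)

lemma nat_le_two_pow (n : ℕ) : (n : ℝ) ≤ 2 ^ n := by
  exact_mod_cast (Nat.lt_two_pow_self (n := n)).le

lemma Ent.summable {a : ℕ → ℝ} (h : Ent a) (z : ℝ) : Summable fun n => a n * z ^ n := by
  refine Summable.of_norm ?_
  refine (h |z| (abs_nonneg z)).congr fun n => ?_
  simp

lemma Ent.mul_nat {a : ℕ → ℝ} (h : Ent a) : Ent (fun n => n * a n) := by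
  intro R hR
  refine Summable.of_nonneg_of_le (fun n => by positivity) (fun n => ?_) (h (2 * R) (by positivity))
  rw [abs_mul, mul_pow, Nat.abs_cast]
  have := nat_le_two_pow n
  calc (n : ℝ) * |a n| * R ^ n ≤ 2 ^ n * |a n| * R ^ n := by gcongr
    _ = _ := by ring

lemma Ent.shift {a : ℕ → ℝ} (h : Ent a) : Ent (fun n => a (n + 1)) := by
  intro R hR
  have h1 := (summable_nat_add_iff 1).2 (h (R + 1) (by positivity))
  refine Summable.of_nonneg_of_le (fun n => by positivity) (fun n => ?_) h1
  have : R ^ n ≤ (R + 1) ^ (n + 1) :=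
    calc R ^ n ≤ (R + 1) ^ n := by gcongr; linarith
      _ ≤ (R + 1) ^ (n + 1) := by apply pow_le_pow_right₀ <;> [linarith; omega]
  gcongr

lemma Ent.const_mul {a : ℕ → ℝ} (h : Ent a) (c : ℝ) : Ent (fun n => c * a n) := by
  intro R hR
  refine ((h R hR).mul_left |c|).congr fun n => ?_
  rw [abs_mul]; ring

lemma Ent.d {a : ℕ → ℝ} (h : Ent a) : Ent (dS a) := by
  have := h.mul_nat.shift
  refine cast ?_ this
  congr 1; ext n; simp [dS]

lemma serS_const_mul (a : ℕ → ℝ) (c z : ℝ) :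
    serS (fun n => c * a n) z = c * serS a z := by
  unfold serS
  rw [← tsum_mul_left]
  simp_rw [mul_assoc]

lemma Ent.mul_d {a : ℕ → ℝ} (h : Ent a) (z : ℝ) :
    serS (fun n => n * a n) z = z * serS (dS a) z := by
  unfold serS
  rw [(h.mul_nat.summable z).tsum_eq_zero_add, ← tsum_mul_left]
  simp only [CharP.cast_eq_zero, zero_mul, zero_add, dS, Nat.cast_add, Nat.cast_one]
  exact tsum_congr fun n => by ring

lemma Ent.hasDerivAt {a : ℕ → ℝ} (h : Ent a) (z : ℝ) :
    HasDerivAt (serS a) (serS (dS a) z) z := by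
  have hz0 : 0 < |z| + 1 := by positivity
  have hu : Summable fun n : ℕ => |(n : ℝ) * a n| * (|z| + 1) ^ (n - 1) := by
    refine (summable_nat_add_iff 1).1 ?_
    refine (h.d (|z| + 1) hz0.le).congr fun n => ?_
    simp [dS]
  have key := hasDerivAt_tsum_of_isPreconnected (g := fun n w => a n * w ^ n)
    (g' := fun n w => a n * (n * w ^ (n - 1))) (t := Ioo (-(|z| + 1)) (|z| + 1))
    (y₀ := 0) (y := z) hu isOpen_Ioo isPreconnected_Ioo
    (fun n y _ => (hasDerivAt_pow n y).const_mul (a n)) ?_ (by constructor <;> linarith)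
    (h.summable 0) (by constructor <;> [linarith [neg_abs_le z]; linarith [le_abs_self z]])
  · convert! key using 1
    unfold serS
    have hs : Summable fun n : ℕ => a n * (n * z ^ (n - 1)) := by
      refine (summable_nat_add_iff 1).1 ?_
      refine (h.d.summable z).congr fun n => ?_
      simp [dS]; ring
    rw [hs.tsum_eq_zero_add]
    simp only [CharP.cast_eq_zero, zero_mul, mul_zero, zero_add, dS, Nat.cast_add, Nat.cast_one,
      Nat.add_sub_cancel]
    exact tsum_congr fun n => by ring
  · intro n y hy
    have : |y| ≤ |z| + 1 := abs_le.2 ⟨hy.1.le, hy.2.le⟩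
    rw [Real.norm_eq_abs, abs_mul, abs_mul, abs_pow, abs_mul]
    calc _ = |(n : ℝ)| * |a n| * |y| ^ (n - 1) := by ring
      _ ≤ _ := by gcongr

lemma Ent.continuous {a : ℕ → ℝ} (h : Ent a) : Continuous (serS a) :=
  continuous_iff_continuousAt.2 fun z => (h.hasDerivAt z).continuousAt

lemma beta_real (u v x : ℝ) (hu : 0 < u) (hv : 0 < v) (hx : 0 < x) :
    ∫ τ in (0:ℝ)..x, τ ^ (u - 1) * (x - τ) ^ (v - 1) =
      x ^ (u + v - 1) * (Real.Gamma u * Real.Gamma v / Real.Gamma (u + v)) := by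
  have h := Complex.betaIntegral_scaled (u : ℂ) (v : ℂ) hx
  rw [Complex.betaIntegral_eq_Gamma_mul_div _ _ (by simpa) (by simpa)] at h
  have e : ∫ τ in (0:ℝ)..x, (τ : ℂ) ^ ((u : ℂ) - 1) * ((x : ℂ) - τ) ^ ((v : ℂ) - 1) =
      ∫ τ in (0:ℝ)..x, (((τ ^ (u - 1) * (x - τ) ^ (v - 1) : ℝ)) : ℂ) := by
    refine intervalIntegral.integral_congr fun τ hτ => ?_
    rw [uIcc_of_le hx.le] at hτ
    rw [Complex.ofReal_mul, Complex.ofReal_cpow hτ.1, Complex.ofReal_cpow (by linarith [hτ.2])]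
    push_cast; rfl
  rw [e, intervalIntegral.integral_ofReal, ← Complex.ofReal_add, Complex.Gamma_ofReal,
    Complex.Gamma_ofReal, Complex.Gamma_ofReal] at h
  have e2 : (x : ℂ) ^ (((u + v : ℝ) : ℂ) - 1) = ((x ^ (u + v - 1) : ℝ) : ℂ) := by
    rw [Complex.ofReal_cpow hx.le]; push_cast; rfl
  rw [e2] at h
  exact_mod_cast h

/-- weak maximum principle for the Caputo integral -/
lemma max_principle (α : ℝ) (hα : α ∈ Ioo (0:ℝ) 1) (f f' : ℝ → ℝ) (x : ℝ) (hx : 0 < x)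
    (hf : ∀ τ, 0 < τ → HasDerivAt f (f' τ) τ) (hfc : ContinuousOn f (Icc 0 x)) (hf' : Continuous f')
    (hmax : ∀ τ ∈ Icc 0 x, f τ ≤ f x) :
    0 ≤ ∫ τ in (0:ℝ)..x, f' τ * (x - τ) ^ (-α) := by
  obtain ⟨h0, h1⟩ := hα
  have hk : IntervalIntegrable (fun τ => (x - τ) ^ (-α)) volume 0 x := by
    have := (intervalIntegral.intervalIntegrable_rpow' (a := 0) (b := x) (r := -α)
      (by linarith)).comp_sub_left x
    simpa using this.symm
  have hfint : IntervalIntegrable (fun τ => f' τ * (x - τ) ^ (-α)) volume 0 x :=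
    hk.continuousOn_mul hf'.continuousOn
  have hbd : ∀ s ∈ Ioo 0 x, (f s - f x) * (x - s) ^ (-α) ≤
      ∫ τ in (0:ℝ)..s, f' τ * (x - τ) ^ (-α) := by
    intro s hs
    have hkd : ∀ τ ∈ Ico 0 x, HasDerivAt (fun τ => (x - τ) ^ (-α)) (α * (x - τ) ^ (-α - 1)) τ := by
      intro τ hτ
      have := ((hasDerivAt_id τ).const_sub x).rpow_const (p := -α) (Or.inl (by
        have := hτ.2; simp; linarith))
      convert! this using 1
      simp
    have hkc : ContinuousOn (fun τ => (x - τ) ^ (-α)) (Icc 0 s) := fun τ hτ =>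
      (hkd τ ⟨hτ.1, by linarith [hτ.2, hs.2]⟩).continuousAt.continuousWithinAt
    have hkc' : ContinuousOn (fun τ => α * (x - τ) ^ (-α - 1)) (Icc 0 s) := by
      refine continuousOn_const.mul (ContinuousOn.rpow_const (by fun_prop) fun τ hτ => Or.inl ?_)
      linarith [hτ.2, hs.2]
    have ibp := intervalIntegral.integral_deriv_mul_eq_sub_of_hasDeriv_right
      (a := 0) (b := s) (u := fun τ => f τ - f x) (u' := f') (v := fun τ => (x - τ) ^ (-α))
      (v' := fun τ => α * (x - τ) ^ (-α - 1)) ?_ ?_ ?_ ?_ ?_ ?_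
    · have e : ∫ τ in (0:ℝ)..s, (f' τ * (x - τ) ^ (-α) + (f τ - f x) * (α * (x - τ) ^ (-α - 1)))
          ≤ ∫ τ in (0:ℝ)..s, f' τ * (x - τ) ^ (-α) := by
        have i1 : ContinuousOn (fun τ => f' τ * (x - τ) ^ (-α)) (Icc 0 s) :=
          hf'.continuousOn.mul hkc
        have i2 : ContinuousOn (fun τ => (f τ - f x) * (α * (x - τ) ^ (-α - 1))) (Icc 0 s) :=
          ((hfc.mono (Icc_subset_Icc_right hs.2.le)).sub continuousOn_const).mul hkc'
        refine intervalIntegral.integral_mono_on hs.1.le ?_ ?_ ?_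
        · refine ContinuousOn.intervalIntegrable ?_
          rw [uIcc_of_le hs.1.le]; exact i1.add i2
        · refine ContinuousOn.intervalIntegrable ?_
          rw [uIcc_of_le hs.1.le]; exact i1
        · intro τ hτ
          have a1 := hmax τ ⟨hτ.1, by linarith [hτ.2, hs.2]⟩
          have a2 : 0 ≤ α * (x - τ) ^ (-α - 1) := by
            have : 0 ≤ x - τ := by linarith [hτ.2, hs.2]
            positivity
          nlinarith
      rw [ibp] at e
      have a1 := hmax 0 ⟨le_rfl, hx.le⟩
      have a2 : 0 ≤ (x - 0) ^ (-α) := by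
        have : 0 ≤ x - 0 := by linarith
        positivity
      nlinarith
    · rw [uIcc_of_le hs.1.le]
      exact (hfc.mono (Icc_subset_Icc_right hs.2.le)).sub continuousOn_const
    · rw [uIcc_of_le hs.1.le]; exact hkc
    · intro τ hτ
      rw [min_eq_left hs.1.le] at hτ
      exact ((hf τ hτ.1).sub_const _).hasDerivWithinAt
    · intro τ hτ
      rw [min_eq_left hs.1.le, max_eq_right hs.1.le] at hτ
      exact (hkd τ ⟨hτ.1.le, by linarith [hτ.2, hs.2]⟩).hasDerivWithinAt
    · exact hf'.intervalIntegrable _ _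
    · refine ContinuousOn.intervalIntegrable ?_
      rw [uIcc_of_le hs.1.le]; exact hkc'
  have hlimG : Tendsto (fun s => ∫ τ in (0:ℝ)..s, f' τ * (x - τ) ^ (-α)) (𝓝[<] x)
      (𝓝 (∫ τ in (0:ℝ)..x, f' τ * (x - τ) ^ (-α))) := by
    have hc := intervalIntegral.continuousOn_primitive_interval
      (μ := volume) (f := fun τ => f' τ * (x - τ) ^ (-α)) (a := 0) (b := x)
      (by rw [uIcc_of_le hx.le]; exact (intervalIntegrable_iff_integrableOn_Icc_of_le hx.le).1 hfint)
    have := hc x (by rw [uIcc_of_le hx.le]; exact ⟨hx.le, le_rfl⟩)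
    rw [uIcc_of_le hx.le] at this
    refine (this.mono_left ?_)
    rw [← nhdsWithin_Ioo_eq_nhdsLT hx]
    exact nhdsWithin_mono _ Ioo_subset_Icc_self
  have hlim0 : Tendsto (fun s => (f s - f x) * (x - s) ^ (-α)) (𝓝[<] x) (𝓝 0) := by
    have hs : Tendsto (fun s => (s - x)⁻¹ * (f s - f x)) (𝓝[<] x) (𝓝 (f' x)) := by
      have := (hf x hx).hasDerivWithinAt (s := Iio x)
      rw [hasDerivWithinAt_iff_tendsto_slope' (by simp)] at this
      refine this.congr fun s => ?_
      simp [slope]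
    have hr : Tendsto (fun s => -(x - s) ^ (1 - α)) (𝓝[<] x) (𝓝 0) := by
      have : Continuous fun s => -(x - s) ^ (1 - α) :=
        ((continuous_const.sub continuous_id).rpow_const fun _ => Or.inr (by linarith)).neg
      have := this.tendsto x
      simp only [sub_self, Real.zero_rpow (by linarith : 1 - α ≠ 0), neg_zero] at this
      exact this.mono_left nhdsWithin_le_nhds
    have := hs.mul hr
    rw [mul_zero] at this
    refine this.congr' ?_
    filter_upwards [self_mem_nhdsWithin] with s hs
    have hs' : 0 < x - s := sub_pos.2 hs
    rw [show (1 - α) = 1 + -α by ring, Real.rpow_add hs', Real.rpow_one]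
    have : s - x ≠ 0 := by linarith
    field_simp
    ring
  refine le_of_tendsto_of_tendsto hlim0 hlimG ?_
  filter_upwards [Ioo_mem_nhdsLT hx] with s hs using hbd s hs

noncomputable def rG (α : ℝ) (n : ℕ) : ℝ :=
  Real.Gamma ((1 + α) * (n + 1) + 1) / Real.Gamma ((1 + α) * n + 2)

lemma caputo_series (α : ℝ) (hα : α ∈ Ioo (0:ℝ) 1) (a : ℕ → ℝ) (ha : Ent a) (x : ℝ) (hx : 0 < x) :
    ∫ τ in (0:ℝ)..x, ((1 + α) * τ ^ α * serS (dS a) (τ ^ (1 + α))) * (x - τ) ^ (-α) =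
      Real.Gamma (1 - α) * x * serS (fun n => a (n + 1) * rG α n) (x ^ (1 + α)) := by
  obtain ⟨h0, h1⟩ := hα
  have hk : IntervalIntegrable (fun τ => (x - τ) ^ (-α)) volume 0 x := by
    have := (intervalIntegral.intervalIntegrable_rpow' (a := 0) (b := x) (r := -α)
      (by linarith)).comp_sub_left x
    simpa using this.symm
  have hpow : ∀ τ : ℝ, 0 < τ → ∀ n : ℕ,
      τ ^ ((1 + α) * (n + 1) - 1) = τ ^ α * (τ ^ (1 + α)) ^ n := by
    intro τ hτ n
    rw [← Real.rpow_natCast, ← Real.rpow_mul hτ.le, ← Real.rpow_add hτ]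
    congr 1; ring
  have key := intervalIntegral.hasSum_integral_of_dominated_convergence (μ := volume)
    (a := 0) (b := x)
    (F := fun n τ => ((1 + α) * dS a n) * (τ ^ ((1 + α) * (n + 1) - 1) * (x - τ) ^ ((1 - α) - 1)))
    (f := fun τ => ((1 + α) * τ ^ α * serS (dS a) (τ ^ (1 + α))) * (x - τ) ^ (-α))
    (bound := fun n τ => (|dS a n| * (x ^ (1 + α)) ^ n) * ((1 + α) * x ^ α * (x - τ) ^ (-α)))
    ?_ ?_ ?_ ?_ ?_
  · rw [← key.tsum_eq, serS, ← tsum_mul_left]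
    refine tsum_congr fun n => ?_
    have hp : 0 < (1 + α) * ((n:ℝ) + 1) := by positivity
    rw [intervalIntegral.integral_const_mul, beta_real _ _ _ hp (by linarith) hx]
    have e1 : (1 + α) * ((n:ℝ) + 1) + (1 - α) - 1 = 1 + (1 + α) * n := by ring
    have e2 : (1 + α) * ((n:ℝ) + 1) + (1 - α) = (1 + α) * n + 2 := by ring
    rw [e1, e2, Real.rpow_add hx, Real.rpow_one, Real.rpow_mul hx.le, Real.rpow_natCast, rG,
      Real.Gamma_add_one hp.ne', dS]
    ring
  · intro n
    refine Measurable.aestronglyMeasurable ?_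
    fun_prop
  · intro n
    refine Eventually.of_forall fun τ hτ => ?_
    rw [uIoc_of_le hx.le] at hτ
    have hxt : 0 ≤ x - τ := by linarith [hτ.2]
    have hτ0 := hτ.1
    rw [hpow τ hτ.1, Real.norm_eq_abs, abs_mul, abs_mul, abs_of_nonneg (by positivity : 0 ≤ 1 + α),
      abs_of_nonneg (by positivity : 0 ≤ τ ^ α * (τ ^ (1 + α)) ^ n * (x - τ) ^ (1 - α - 1)),
      show 1 - α - 1 = -α by ring]
    calc _ ≤ (1 + α) * |dS a n| * (x ^ α * (x ^ (1 + α)) ^ n * (x - τ) ^ (-α)) := by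
          have := hτ.2
          gcongr
      _ = _ := by ring
  · refine Eventually.of_forall fun τ hτ => ?_
    exact (ha.d _ (by positivity)).mul_right _
  · simp_rw [tsum_mul_right]
    exact (hk.const_mul _).const_mul _
  · refine Eventually.of_forall fun τ hτ => ?_
    rw [uIoc_of_le hx.le] at hτ
    have := (ha.d.summable (τ ^ (1 + α))).hasSum.mul_left ((1 + α) * τ ^ α)
    have := this.mul_right ((x - τ) ^ (-α))
    refine cast ?_ this
    congr 1; ext n
    rw [hpow τ hτ.1, show 1 - α - 1 = -α by ring]
    ring

lemma ser_hasDerivAt (α : ℝ) (hα : α ∈ Ioo (0:ℝ) 1) (a : ℕ → ℝ) (ha : Ent a) (x : ℝ) :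
    HasDerivAt (fun τ => serS a (τ ^ (1 + α)))
      ((1 + α) * x ^ α * serS (dS a) (x ^ (1 + α))) x := by
  have h1 := Real.hasDerivAt_rpow_const (x := x) (p := 1 + α) (Or.inr (by linarith [hα.1]))
  have := (ha.hasDerivAt (x ^ (1 + α))).comp x h1
  convert! this using 1
  simp; ring

lemma ser_max (α : ℝ) (hα : α ∈ Ioo (0:ℝ) 1) (a : ℕ → ℝ) (ha : Ent a) (x : ℝ) (hx : 0 < x)
    (hmax : ∀ τ ∈ Icc 0 x, serS a (τ ^ (1 + α)) ≤ serS a (x ^ (1 + α))) :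
    0 ≤ serS (fun n => a (n + 1) * rG α n) (x ^ (1 + α)) := by
  have h := max_principle α hα (fun τ => serS a (τ ^ (1 + α)))
    (fun x => (1 + α) * x ^ α * serS (dS a) (x ^ (1 + α))) x hx
    (fun τ _ => ser_hasDerivAt α hα a ha τ)
    (fun τ _ => (ser_hasDerivAt α hα a ha τ).continuousAt.continuousWithinAt)
    ?_ hmax
  · rw [caputo_series α hα a ha x hx] at h
    have : 0 < Real.Gamma (1 - α) * x :=
      mul_pos (Real.Gamma_pos_of_pos (by linarith [hα.2])) hx
    exact nonneg_of_mul_nonneg_right h this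
  · refine Continuous.mul (continuous_const.mul ?_) (ha.d.continuous.comp ?_)
    · exact Real.continuous_rpow_const hα.1.le
    · exact Real.continuous_rpow_const (by linarith [hα.1])

noncomputable def aP (α : ℝ) (n : ℕ) : ℝ := bCoef α n * (-(1 + α)⁻¹) ^ n

lemma Phi_eq (α x : ℝ) : Phi α x = serS (aP α) (x ^ (1 + α)) := by
  unfold Phi serS aP
  refine tsum_congr fun n => ?_
  rw [mul_assoc, ← mul_pow]
  congr 2; rw [div_eq_mul_inv]; ring

lemma bCoef_succ (α : ℝ) (hα : α ∈ Ioo (0:ℝ) 1) (n : ℕ) : bCoef α (n + 1) * rG α n = bCoef α n := by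
  have h0 := hα.1
  unfold bCoef rG
  rw [Finset.prod_range_succ]
  have e1 : (1 + α) * ((n:ℝ) + 1) + 1 = α * (n + 1) + n + 2 := by ring
  have e2 : (1 + α) * (n:ℝ) + 2 = α * n + n + 2 := by ring
  rw [e1, e2]
  have p1 : 0 < Real.Gamma (α * (n + 1) + n + 2) := Real.Gamma_pos_of_pos (by positivity)
  have p2 : 0 < Real.Gamma (α * n + n + 2) := Real.Gamma_pos_of_pos (by positivity)
  rw [mul_assoc, div_mul_div_cancel₀ p1.ne', div_self p2.ne', mul_one]

lemma bCoef_pos (α : ℝ) (hα : α ∈ Ioo (0:ℝ) 1) (n : ℕ) : 0 < bCoef α n := by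
  have h0 := hα.1
  refine Finset.prod_pos fun i _ => div_pos ?_ ?_ <;> exact Real.Gamma_pos_of_pos (by positivity)

lemma bCoef_le (α : ℝ) (hα : α ∈ Ioo (0:ℝ) 1) (n : ℕ) : bCoef α n ≤ 1 := by
  have h0 := hα.1
  refine Finset.prod_le_one (fun i _ => ?_) fun i _ => ?_
  · exact (div_pos (Real.Gamma_pos_of_pos (by positivity))
      (Real.Gamma_pos_of_pos (by positivity))).le
  · rw [div_le_one (Real.Gamma_pos_of_pos (by positivity))]
    refine Real.Gamma_strictMonoOn_Ici.monotoneOn ?_ ?_ ?_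
    · simp; positivity
    · simp; positivity
    · nlinarith

lemma aP_succ (α : ℝ) (hα : α ∈ Ioo (0:ℝ) 1) (n : ℕ) :
    aP α (n + 1) * rG α n = -(1 + α)⁻¹ * aP α n := by
  unfold aP
  rw [← bCoef_succ α hα n]; ring

lemma rG_lower (α : ℝ) (hα : α ∈ Ioo (0:ℝ) 1) (n : ℕ) :
    (((1 + α) * n + 2) ^ α) / 2 ≤ rG α n := by
  obtain ⟨h0, h1⟩ := hα
  set z : ℝ := (1 + α) * n + 2 with hz
  have hz2 : 2 ≤ z := by have : 0 ≤ (1 + α) * n := by positivity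
                         linarith
  have hzp : 0 < z := by linarith
  have e : (1 + α) * ((n:ℝ) + 1) + 1 = z + α := by rw [hz]; ring
  have hG := Real.Gamma_pos_of_pos hzp
  have hG' := Real.Gamma_pos_of_pos (by linarith : 0 < z + α)
  rw [rG, e, ← hz, le_div_iff₀ hG]
  have h := Real.Gamma_mul_add_mul_le_rpow_Gamma_mul_rpow_Gamma (s := z + α) (t := z + α + 1)
    (a := α) (b := 1 - α) (by linarith) (by linarith) h0 (by linarith) (by ring)
  rw [show α * (z + α) + (1 - α) * (z + α + 1) = z + 1 by ring, Real.Gamma_add_one hzp.ne',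
    Real.Gamma_add_one (by linarith : z + α ≠ 0), Real.mul_rpow (by linarith) hG'.le] at h
  have e2 : Real.Gamma (z + α) ^ α * ((z + α) ^ (1 - α) * Real.Gamma (z + α) ^ (1 - α)) =
      (z + α) ^ (1 - α) * Real.Gamma (z + α) := by
    have : Real.Gamma (z + α) ^ α * Real.Gamma (z + α) ^ (1 - α) = Real.Gamma (z + α) := by
      rw [← Real.rpow_add hG']; simp
    calc _ = (z + α) ^ (1 - α) * (Real.Gamma (z + α) ^ α * Real.Gamma (z + α) ^ (1 - α)) := by ring
      _ = _ := by rw [this]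
  rw [e2] at h
  have e3 : (z + α) ^ (1 - α) ≤ 2 * z ^ (1 - α) := by
    calc (z + α) ^ (1 - α) ≤ (2 * z) ^ (1 - α) := by gcongr <;> linarith
      _ = 2 ^ (1 - α) * z ^ (1 - α) := Real.mul_rpow (by norm_num) hzp.le
      _ ≤ 2 ^ (1:ℝ) * z ^ (1 - α) := by gcongr <;> linarith
      _ = _ := by simp
  have e4 : z ^ α * z ^ (1 - α) = z := by rw [← Real.rpow_add hzp]; simp
  have p1 : 0 < z ^ (1 - α) := by positivity
  have h5 : z * Real.Gamma z ≤ 2 * z ^ (1 - α) * Real.Gamma (z + α) :=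
    h.trans (by gcongr)
  refine le_of_mul_le_mul_left ?_ p1
  calc z ^ (1 - α) * (z ^ α / 2 * Real.Gamma z) = (z ^ α * z ^ (1 - α)) * Real.Gamma z / 2 := by ring
    _ = z * Real.Gamma z / 2 := by rw [e4]
    _ ≤ _ := by linarith

lemma aP_ent (α : ℝ) (hα : α ∈ Ioo (0:ℝ) 1) : Ent (aP α) := by
  intro R hR
  have h0 := hα.1
  have hT : Tendsto (fun n : ℕ => (((1 + α) * (n:ℝ) + 2) ^ α) / 2) atTop atTop := by
    refine Tendsto.atTop_div_const (by norm_num) ((tendsto_rpow_atTop h0).comp ?_)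
    refine tendsto_atTop_add_const_right _ _ ?_
    exact tendsto_natCast_atTop_atTop.const_mul_atTop (by linarith)
  refine summable_of_ratio_norm_eventually_le (r := 1 / 2) (by norm_num) ?_
  filter_upwards [hT.eventually_ge_atTop (2 * R + 1)] with n hn
  have hr := hn.trans (rG_lower α hα n)
  have hs := congrArg abs (aP_succ α hα n)
  rw [abs_mul, abs_mul, abs_neg, abs_of_nonneg (by linarith : 0 ≤ rG α n),
    abs_of_nonneg (by positivity : 0 ≤ (1 + α)⁻¹)] at hs
  have hc : (1 + α)⁻¹ ≤ 1 := inv_le_one_of_one_le₀ (by linarith)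
  rw [norm_mul, norm_mul, norm_pow, norm_pow, Real.norm_eq_abs, Real.norm_eq_abs,
    Real.norm_eq_abs, abs_abs, abs_abs, abs_of_nonneg hR, pow_succ]
  have h3 : |aP α (n + 1)| * (2 * R) ≤ |aP α n| := by
    calc |aP α (n + 1)| * (2 * R) ≤ |aP α (n + 1)| * rG α n := by gcongr; linarith
      _ = (1 + α)⁻¹ * |aP α n| := hs
      _ ≤ 1 * |aP α n| := by gcongr
      _ = _ := one_mul _
  calc |aP α (n + 1)| * (R ^ n * R) = (1/2) * ((|aP α (n + 1)| * (2 * R)) * R ^ n) := by ring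
    _ ≤ _ := by gcongr

lemma ser_zero (a : ℕ → ℝ) : serS a 0 = a 0 := by
  unfold serS
  rw [tsum_eq_single 0 (fun n hn => by simp [hn])]; simp

lemma ser_rpow_zero (α : ℝ) (hα : α ∈ Ioo (0:ℝ) 1) (a : ℕ → ℝ) :
    serS a ((0:ℝ) ^ (1 + α)) = a 0 := by
  rw [Real.zero_rpow (by linarith [hα.1]), ser_zero]

lemma aP_zero (α : ℝ) : aP α 0 = 1 := by simp [aP, bCoef]

/-- extremal form: if the value at some point exceeds both `M` and the initial value then there is
a running-maximum point where it does so, and the fractional derivative there is nonnegative. -/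
lemma ser_exists (α : ℝ) (hα : α ∈ Ioo (0:ℝ) 1) (a : ℕ → ℝ) (ha : Ent a) (M : ℝ) (hM : a 0 ≤ M)
    (x : ℝ) (hx : 0 ≤ x) (h : M < serS a (x ^ (1 + α))) :
    ∃ y, 0 < y ∧ M < serS a (y ^ (1 + α)) ∧
      0 ≤ serS (fun n => a (n + 1) * rG α n) (y ^ (1 + α)) := by
  have hc : Continuous (fun τ : ℝ => serS a (τ ^ (1 + α))) :=
    continuous_iff_continuousAt.2 fun τ => (ser_hasDerivAt α hα a ha τ).continuousAt
  obtain ⟨y, hy, hmax⟩ := (isCompact_Icc (a := (0:ℝ)) (b := x)).exists_isMaxOn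
    ⟨0, le_rfl, hx⟩ hc.continuousOn
  have hMy : M < serS a (y ^ (1 + α)) := h.trans_le (hmax ⟨hx, le_rfl⟩)
  have hy0 : 0 < y := by
    rcases hy.1.eq_or_lt with h' | h'
    · rw [← h', ser_rpow_zero α hα] at hMy; linarith
    · exact h'
  exact ⟨y, hy0, hMy, ser_max α hα a ha y hy0 fun τ hτ => hmax ⟨hτ.1, hτ.2.trans hy.2⟩⟩

lemma Phi_nonneg (α : ℝ) (hα : α ∈ Ioo (0:ℝ) 1) (x : ℝ) (hx : 0 ≤ x) : 0 ≤ Phi α x := by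
  by_contra! hneg
  rw [Phi_eq] at hneg
  obtain ⟨y, hy, h1, h2⟩ := ser_exists α hα (fun n => (-1) * aP α n) ((aP_ent α hα).const_mul _) 0
    (by simp [aP_zero]) x hx (by rw [serS_const_mul]; linarith)
  rw [serS_const_mul] at h1
  have e : (fun n => (-1) * aP α (n + 1) * rG α n) = fun n => (1 + α)⁻¹ * aP α n := by
    ext n; rw [mul_assoc, aP_succ α hα]; ring
  rw [e, serS_const_mul] at h2
  have : 0 < (1 + α)⁻¹ := by have := hα.1; positivity
  nlinarith

lemma Phi_le_one (α : ℝ) (hα : α ∈ Ioo (0:ℝ) 1) (x : ℝ) (hx : 0 ≤ x) : Phi α x ≤ 1 := by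
  by_contra! hneg
  rw [Phi_eq] at hneg
  obtain ⟨y, hy, h1, h2⟩ := ser_exists α hα (aP α) (aP_ent α hα) 1
    (by simp [aP_zero]) x hx hneg
  have e : (fun n => aP α (n + 1) * rG α n) = fun n => -(1 + α)⁻¹ * aP α n := by
    ext n; rw [aP_succ α hα]
  rw [e, serS_const_mul] at h2
  have : 0 < (1 + α)⁻¹ := by have := hα.1; positivity
  nlinarith

noncomputable def aW (α : ℝ) (n : ℕ) : ℝ := (1 + α) * (n * aP α n)

lemma aW_ent (α : ℝ) (hα : α ∈ Ioo (0:ℝ) 1) : Ent (aW α) :=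
  ((aP_ent α hα).mul_nat).const_mul _

lemma aW_succ (α : ℝ) (hα : α ∈ Ioo (0:ℝ) 1) (z : ℝ) :
    serS (fun n => aW α (n + 1) * rG α n) z =
      -(serS (aP α) z + (1 + α)⁻¹ * serS (aW α) z) := by
  have h0 := hα.1
  have e : (fun n => aW α (n + 1) * rG α n) = fun n => (-1) * (aP α n + (1 + α)⁻¹ * aW α n) := by
    ext n
    have := aP_succ α hα n
    unfold aW
    rw [mul_assoc, mul_assoc, this]
    push_cast
    field_simp
    ring
  rw [e, serS_const_mul]
  have h1 := (aP_ent α hα).summable z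
  have h2 := ((aW_ent α hα).const_mul (1 + α)⁻¹).summable z
  rw [← serS_const_mul (aW α)]
  unfold serS
  rw [← h1.tsum_add h2, neg_one_mul]
  congr 1
  exact tsum_congr fun n => by ring

lemma W_le (α : ℝ) (hα : α ∈ Ioo (0:ℝ) 1) (x : ℝ) (hx : 0 ≤ x) :
    serS (aW α) (x ^ (1 + α)) ≤ 0 := by
  by_contra! hneg
  obtain ⟨y, hy, h1, h2⟩ := ser_exists α hα (aW α) (aW_ent α hα) 0
    (by simp [aW]) x hx hneg
  rw [aW_succ α hα, ← Phi_eq] at h2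
  have := Phi_nonneg α hα y hy.le
  have : 0 < (1 + α)⁻¹ := by have := hα.1; positivity
  nlinarith

lemma W_ge (α : ℝ) (hα : α ∈ Ioo (0:ℝ) 1) (x : ℝ) (hx : 0 ≤ x) :
    -(1 + α) ≤ serS (aW α) (x ^ (1 + α)) := by
  by_contra! hneg
  have h0 := hα.1
  obtain ⟨y, hy, h1, h2⟩ := ser_exists α hα (fun n => (-1) * aW α n) ((aW_ent α hα).const_mul _)
    (1 + α) (by simp [aW]; linarith) x hx (by rw [serS_const_mul]; linarith)
  rw [serS_const_mul] at h1
  have e : (fun n => (-1) * aW α (n + 1) * rG α n) =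
      fun n => (-1) * (aW α (n + 1) * rG α n) := by ext n; ring
  rw [e, serS_const_mul, aW_succ α hα, ← Phi_eq] at h2
  have h3 := Phi_le_one α hα y hy.le
  have h4 : (1 + α)⁻¹ * (1 + α) = 1 := inv_mul_cancel₀ (by linarith)
  have : 0 < (1 + α)⁻¹ := by positivity
  nlinarith

noncomputable def dPhi (α x : ℝ) : ℝ := (1 + α) * x ^ α * serS (dS (aP α)) (x ^ (1 + α))

lemma Phi_hasDerivAt (α : ℝ) (hα : α ∈ Ioo (0:ℝ) 1) (x : ℝ) :
    HasDerivAt (Phi α) (dPhi α x) x := by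
  have := ser_hasDerivAt α hα (aP α) (aP_ent α hα) x
  rwa [← (funext fun x => Phi_eq α x : Phi α = _)] at this

lemma dPhi_far (α : ℝ) (hα : α ∈ Ioo (0:ℝ) 1) (x : ℝ) (hx : 0 < x) : |dPhi α x| ≤ 2 / x := by
  have e : x * dPhi α x = serS (aW α) (x ^ (1 + α)) := by
    have : aW α = fun n => (1 + α) * (n * aP α n) := rfl
    rw [this, serS_const_mul (fun n => n * aP α n), (aP_ent α hα).mul_d, dPhi]
    have e1 : x ^ (1 + α) = x * x ^ α := by rw [Real.rpow_add hx, Real.rpow_one]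
    generalize serS (dS (aP α)) (x ^ (1 + α)) = q
    rw [e1]; ring
  rw [le_div_iff₀ hx]
  have h1 := W_le α hα x hx.le
  have h2 := W_ge α hα x hx.le
  rw [← e] at h1 h2
  have : |x * dPhi α x| ≤ 2 := abs_le.2 ⟨by linarith [hα.2], by linarith⟩
  rwa [abs_mul, abs_of_pos hx, mul_comm] at this

lemma dPhi_near (α : ℝ) (hα : α ∈ Ioo (0:ℝ) 1) (x : ℝ) (hx : 0 ≤ x) (hx2 : x ≤ 1 / 2) :
    |dPhi α x| ≤ 4 := by
  have h0 := hα.1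
  have hsum : HasSum (fun n : ℕ => ((n:ℝ) + 1) * (1/2) ^ n) 4 := by
    have h1 := hasSum_coe_mul_geometric_of_norm_lt_one (r := (1/2:ℝ)) (by norm_num)
    have h2 := hasSum_geometric_two
    have := h1.add h2
    convert! this using 1
    · ext n; ring
    · norm_num
  have hxp : x ^ (1 + α) ≤ 1 / 2 := by
    calc x ^ (1 + α) ≤ (1/2 : ℝ) ^ (1 + α) := by gcongr
      _ ≤ (1/2 : ℝ) ^ (1:ℝ) := Real.rpow_le_rpow_of_exponent_ge (by norm_num) (by norm_num)
        (by linarith)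
      _ = 1/2 := by simp
  have hxp0 : 0 ≤ x ^ (1 + α) := by positivity
  have hS : |serS (dS (aP α)) (x ^ (1 + α))| ≤ (1 + α)⁻¹ * 4 := by
    rw [← Real.norm_eq_abs]
    refine tsum_of_norm_bounded (hsum.mul_left (1 + α)⁻¹) fun n => ?_
    have ha : |aP α (n + 1)| ≤ (1 + α)⁻¹ := by
      unfold aP
      rw [abs_mul, abs_pow, abs_neg, abs_of_pos (bCoef_pos α hα _),
        abs_of_nonneg (by positivity : 0 ≤ (1 + α)⁻¹), pow_succ]
      have hc : (1 + α)⁻¹ ≤ 1 := inv_le_one_of_one_le₀ (by linarith)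
      calc _ ≤ 1 * (1 ^ n * (1 + α)⁻¹) := by
            gcongr
            exact bCoef_le α hα _
        _ = _ := by simp
    rw [Real.norm_eq_abs, dS, abs_mul, abs_mul, abs_pow, abs_of_nonneg hxp0,
      abs_of_nonneg (by positivity : (0:ℝ) ≤ n + 1)]
    calc _ ≤ ((n:ℝ) + 1) * (1 + α)⁻¹ * (1/2) ^ n := by gcongr
      _ = _ := by ring
  have hxa : x ^ α ≤ 1 := Real.rpow_le_one hx (by linarith) h0.le
  rw [dPhi, abs_mul, abs_of_nonneg (by positivity : 0 ≤ (1 + α) * x ^ α)]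
  calc _ ≤ (1 + α) * 1 * ((1 + α)⁻¹ * 4) := by gcongr
    _ = 4 := by field_simp

lemma dPhi_le (α : ℝ) (hα : α ∈ Ioo (0:ℝ) 1) (x : ℝ) (hx : 0 ≤ x) : |dPhi α x| ≤ 4 := by
  rcases le_total x (1/2) with h | h
  · exact dPhi_near α hα x hx h
  · refine (dPhi_far α hα x (by linarith)).trans ?_
    rw [div_le_iff₀ (by linarith)]; linarith

lemma Phi_lip (α : ℝ) (hα : α ∈ Ioo (0:ℝ) 1) (s : Set ℝ) (hs : Convex ℝ s) (C : ℝ)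
    (hC : ∀ x ∈ s, |dPhi α x| ≤ C) (x y : ℝ) (hx : x ∈ s) (hy : y ∈ s) :
    |Phi α y - Phi α x| ≤ C * |y - x| :=
  hs.norm_image_sub_le_of_norm_hasDerivWithin_le
    (fun z _ => (Phi_hasDerivAt α hα z).hasDerivWithinAt) hC hx hy

lemma Phi_key (α : ℝ) (hα : α ∈ Ioo (0:ℝ) 1) (X Y : ℝ) (hX : 0 < X) (hY : 0 < Y) :
    |Phi α |X - Y| - Phi α X| ≤ 4 * Y * (if X ≤ 1 then 1 else 1 / X) := by
  have hXY : |(|X - Y|) - X| ≤ Y := by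
    have := abs_abs_sub_abs_le (X - Y) X
    rwa [abs_of_pos hX, show X - Y - X = -Y by ring, abs_neg, abs_of_pos hY] at this
  split_ifs with h
  · have := Phi_lip α hα (Ici 0) (convex_Ici 0) 4 (fun x hx => dPhi_le α hα x hx) X |X - Y|
      hX.le (mem_Ici.2 (abs_nonneg _))
    linarith
  · push Not at h
    rcases le_total (X / 4) Y with h' | h'
    · have h1 := Phi_nonneg α hα X hX.le
      have h2 := Phi_le_one α hα X hX.le
      have h3 := Phi_nonneg α hα |X - Y| (abs_nonneg _)
      have h4 := Phi_le_one α hα |X - Y| (abs_nonneg _)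
      have h5 : |Phi α |X - Y| - Phi α X| ≤ 1 := abs_le.2 ⟨by linarith, by linarith⟩
      refine h5.trans ?_
      rw [mul_one_div, le_div_iff₀ hX]; linarith
    · have := Phi_lip α hα (Ici (3 * X / 4)) (convex_Ici _) (4 / X) (fun x hx => ?_) X |X - Y|
        (by simp only [mem_Ici]; linarith)
        (by simp only [mem_Ici]; have := le_abs_self (X - Y); linarith)
      · calc _ ≤ _ := this
          _ ≤ 4 / X * Y := by gcongr
          _ = _ := by ring
      · simp only [mem_Ici] at hx
        refine (dPhi_far α hα x (by linarith)).trans ?_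
        rw [div_le_div_iff₀ (by linarith) hX]; linarith

lemma C1_ge (α : ℝ) (hα : α ∈ Ioo (0:ℝ) 1) : 2 ≤ C1 α := by
  obtain ⟨h0, h1⟩ := hα
  have hi0 : IntervalIntegrable (fun u : ℝ => u ^ (α - 1)) volume (1 - 1/2) (1 - 1) :=
    intervalIntegral.intervalIntegrable_rpow' (by linarith)
  have hi : IntervalIntegrable (fun u : ℝ => (1 - u) ^ (α - 1)) volume (1/2) 1 := by
    have := hi0.comp_sub_left 1
    simpa using this
  have hv : ∫ u in (1/2:ℝ)..1, (1 - u) ^ (α - 1) = (1/2) ^ α / α := by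
    rw [intervalIntegral.integral_comp_sub_left (fun u : ℝ => u ^ (α - 1)),
      integral_rpow (Or.inl (by linarith))]
    norm_num [Real.zero_rpow h0.ne']
  have hcont : ContinuousOn (fun u : ℝ => u ^ (-(1 + α))) (uIcc (1/2) 1) := by
    refine continuousOn_id.rpow_const fun u hu => Or.inl ?_
    rw [uIcc_of_le (by norm_num)] at hu
    have := hu.1
    simp only [id]; linarith
  have hle : (1/2) ^ α / α ≤ ∫ u in (1/2:ℝ)..1, u ^ (-(1+α)) * (1-u) ^ (α-1) := by
    rw [← hv]
    refine intervalIntegral.integral_mono_on (by norm_num) hi (hi.continuousOn_mul hcont) ?_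
    intro u hu
    have hu1 := hu.1
    have a1 : 0 ≤ 1 - u := by linarith [hu.2]
    have a2 : 1 ≤ u ^ (-(1 + α)) :=
      Real.one_le_rpow_of_pos_of_le_one_of_nonpos (by linarith) hu.2 (by linarith)
    exact le_mul_of_one_le_left (by positivity) a2
  unfold C1
  calc (2:ℝ) = α * 2 ^ (1 + α) * ((1/2) ^ α / α) := by
        rw [Real.rpow_add (by norm_num), Real.rpow_one, Real.div_rpow (by norm_num) (by norm_num),
          Real.one_rpow]
        have : (2:ℝ) ^ α ≠ 0 := by positivity
        field_simp
    _ ≤ _ := by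
        gcongr
        exact hle.trans (le_max_left _ _)

lemma a0_nonneg (α : ℝ) (hα : α ∈ Ioo (0:ℝ) 1) : 0 ≤ a0 α := by
  refine inv_nonneg.2 (mul_nonneg (by norm_num) ?_)
  exact setIntegral_nonneg measurableSet_Ioi fun x hx => Phi_nonneg α hα x (le_of_lt hx)

/-- Pointwise bound for `v⁻(x,t) − m·𝔈_t(x)` from Lemma 5 of the paper. -/
theorem stmt10 (α : ℝ) (hα : α ∈ Set.Ioo (0:ℝ) 1) (g : ℝ → ℝ)
    (hg : IntegrableOn g (Set.Ioi 0))
    (hyg : IntegrableOn (fun y => y * g y) (Set.Ioi 0))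
    (hsupp : HasCompactSupport g)
    (t : ℝ) (ht : 1 < t) (x : ℝ) (hx : 0 < x) :
    |(∫ y in Set.Ioi (0:ℝ), fundSol α t (x - y) * g y) -
        (∫ y in Set.Ioi (0:ℝ), g y) * fundSol α t x| ≤
      C2 α / t ^ (1/(1+α)) * (∫ y in Set.Ioi (0:ℝ), |y * g y|) *
        (if x ≤ t ^ (1/(1+α)) then t ^ (-1/(1+α)) else 1/x) := by
  have h0 := hα.1
  have ht0 : 0 < t := by linarith
  obtain ⟨T, hT⟩ : ∃ T, T = t ^ (-1/(1+α)) := ⟨_, rfl⟩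
  have hTp : 0 < T := by rw [hT]; positivity
  have hTi : t ^ (1/(1+α)) = T⁻¹ := by
    rw [hT, ← Real.rpow_neg ht0.le]; congr 1; ring
  have ha0 := a0_nonneg α hα
  have hC1 := C1_ge α hα
  have hfs : ∀ z, fundSol α t z = a0 α * T * Phi α (|z| * T) := fun z => by rw [fundSol, hT]
  rw [hTi, ← hT]
  have hPc : Continuous (Phi α) :=
    continuous_iff_continuousAt.2 fun z => (Phi_hasDerivAt α hα z).continuousAt
  have hi1 : IntegrableOn (fun y => fundSol α t (x - y) * g y) (Ioi 0) := by
    refine Integrable.bdd_mul (c := a0 α * T * 1) hg ?_ ?_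
    · refine Continuous.aestronglyMeasurable ?_
      simp_rw [hfs]
      fun_prop
    · refine Eventually.of_forall fun y => ?_
      have p1 := Phi_nonneg α hα (|x - y| * T) (by positivity)
      have p2 := Phi_le_one α hα (|x - y| * T) (by positivity)
      rw [hfs, Real.norm_eq_abs, abs_of_nonneg (by positivity)]
      gcongr
  have hi2 : IntegrableOn (fun y => g y * fundSol α t x) (Ioi 0) := hg.mul_const _
  rw [← integral_mul_const, ← integral_sub hi1 hi2]
  obtain ⟨K, hK⟩ : ∃ K : ℝ, K = if x ≤ T⁻¹ then T else 1 / x := ⟨_, rfl⟩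
  rw [← hK]
  have hK0 : 0 ≤ K := by rw [hK]; split_ifs <;> positivity
  have hKe : T * (if x * T ≤ 1 then 1 else 1 / (x * T)) = K := by
    have : x * T ≤ 1 ↔ x ≤ T⁻¹ := by rw [← one_div, le_div_iff₀ hTp]
    rw [hK]; simp only [this]
    split_ifs
    · simp
    · field_simp
  have hpt : ∀ y ∈ Ioi (0:ℝ), ‖fundSol α t (x - y) * g y - g y * fundSol α t x‖ ≤
      C2 α / T⁻¹ * K * |y * g y| := by
    intro y hy
    have hy0 : 0 < y := hy
    have key := Phi_key α hα (x * T) (y * T) (by positivity) (by positivity)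
    have e1 : |x - y| * T = |x * T - y * T| := by
      rw [← sub_mul, abs_mul, abs_of_pos hTp]
    have e2 : fundSol α t (x - y) * g y - g y * fundSol α t x =
        a0 α * T * (Phi α |x * T - y * T| - Phi α (x * T)) * g y := by
      rw [hfs, hfs, e1, abs_of_pos hx]; ring
    rw [e2, Real.norm_eq_abs, abs_mul, abs_mul, abs_of_nonneg (by positivity : 0 ≤ a0 α * T),
      abs_mul, abs_of_pos hy0]
    have key2 : |Phi α |x * T - y * T| - Phi α (x * T)| ≤ 4 * y * K := by
      refine key.trans (le_of_eq ?_)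
      rw [← hKe]; ring
    calc _ ≤ a0 α * T * (4 * y * K) * |g y| := by gcongr
      _ = (2 * a0 α * 2) * T * K * (y * |g y|) := by ring
      _ ≤ (2 * a0 α * C1 α) * T * K * (y * |g y|) := by gcongr
      _ = _ := by rw [C2, div_inv_eq_mul]
  rw [← Real.norm_eq_abs]
  have hb := norm_integral_le_of_norm_le (μ := volume.restrict (Ioi 0))
    (hyg.abs.const_mul (C2 α / T⁻¹ * K))
    ((ae_restrict_iff' measurableSet_Ioi).2 (Eventually.of_forall hpt))
  rw [integral_const_mul] at hb
  calc _ ≤ _ := hb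
    _ = _ := by ring
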